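/- Fix a > 0, α > 0 and b ≥ 0, and for each n > 0 let s*(n) denote the unique root in (0, n) of F(s) = α·a·n·s^(−α−1) − (α+1)·a·s^(−α) − b. Then for every n > 0 the derivative of the fraction s*(n)/n with respect to n satisfies the two-sided bound 0 ≥ d/dn (s*(n)/n) ≥ −(α/(α+1))·(b/a)·n^(α−1); in particular, when α < 1 this derivative is uniformly bounded over n ≥ 1. -/

import Mathlib

open Filter Topology

/-- The equation of the root of `F`, solved for `n`. -/
lemma eq_of_root {a α b n s : ℝ} (ha : 0 < a) (hα : 0 < α) (hs : 0 < s)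
    (h : α * a * n * s ^ (-α - 1) - (α + 1) * a * s ^ (-α) - b = 0) :
    (α + 1) / α * s + b / (a * α) * s ^ (α + 1) = n := by
  have hp : 0 < s ^ α := Real.rpow_pos_of_pos hs α
  rw [Real.rpow_sub_one hs.ne', Real.rpow_neg hs.le] at h
  rw [Real.rpow_add_one hs.ne']
  field_simp at h ⊢
  linarith

/-- A right inverse, with positive values on `(0, ∞)`, of a function that is strictly increasing
there is continuous on `(0, ∞)`. -/
lemma continuousAt_of_strictMonoOn_rightInverse {g s : ℝ → ℝ}
    (hg : StrictMonoOn g (Set.Ioi 0)) (hg0 : ∀ x, 0 < x → 0 < g x)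
    (hs : ∀ n, 0 < n → 0 < s n) (hgs : ∀ n, 0 < n → g (s n) = n) {n : ℝ} (hn : 0 < n) :
    ContinuousAt s n := by
  have hmono : StrictMonoOn s (Set.Ioi 0) := fun x hx y hy hxy => by
    rwa [← hg.lt_iff_lt (hs x hx) (hs y hy), hgs x hx, hgs y hy]
  refine hmono.continuousAt_of_image_mem_nhds (Ioi_mem_nhds hn) ?_
  refine mem_of_superset (Ioi_mem_nhds (hs n hn)) fun x hx => ?_
  exact ⟨g x, hg0 x hx, hg.injOn (hs _ (hg0 x hx)) hx (hgs _ (hg0 x hx))⟩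

/-- The derivative of the fraction `s n / n`, where `s n` is the root of `F`. -/
lemma hasDerivAt_root_div {a α b : ℝ} (ha : 0 < a) (hα : 0 < α) (hb : 0 ≤ b) {s : ℝ → ℝ}
    (hs : ∀ n, 0 < n → 0 < s n)
    (hroot : ∀ n, 0 < n → (α + 1) / α * s n + b / (a * α) * s n ^ (α + 1) = n)
    {n : ℝ} (hn : 0 < n) :
    HasDerivAt (fun n => s n / n)
      (-(α / (α + 1) * (b / a * s n ^ α * s n / ((1 + b / a * s n ^ α) * n ^ 2)))) n := by
  have hsn := hs n hn
  have hcont : ContinuousAt s n := by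
    refine continuousAt_of_strictMonoOn_rightInverse
      (g := fun x => (α + 1) / α * x + b / (a * α) * x ^ (α + 1)) ?_ ?_ hs hroot hn
    · intro x hx y _ hxy
      have hx' : 0 ≤ x := le_of_lt hx
      have hpow : x ^ (α + 1) ≤ y ^ (α + 1) := Real.rpow_le_rpow hx' hxy.le (by positivity)
      exact add_lt_add_of_lt_of_le (mul_lt_mul_of_pos_left hxy (by positivity))
        (mul_le_mul_of_nonneg_left hpow (by positivity))
    · intro x hx
      positivity
  have hg : HasDerivAt (fun x => (α + 1) / α * x + b / (a * α) * x ^ (α + 1))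
      ((α + 1) / α * (1 + b / a * s n ^ α)) (s n) := by
    refine (((hasDerivAt_id (s n)).const_mul ((α + 1) / α)).add
      ((Real.hasDerivAt_rpow_const (p := α + 1) (Or.inl hsn.ne')).const_mul
        (b / (a * α)))).congr_deriv ?_
    rw [add_sub_cancel_right]
    field_simp
  have hderiv : HasDerivAt s ((α + 1) / α * (1 + b / a * s n ^ α))⁻¹ n :=
    hg.of_local_left_inverse hcont (by positivity)
      (by filter_upwards [Ioi_mem_nhds hn] with m hm using hroot m hm)
  refine (hderiv.div (hasDerivAt_id n) hn.ne').congr_deriv ?_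
  have hn_eq : n = s n * (α + 1 + b / a * s n ^ α) / α := by
    conv_lhs => rw [← hroot n hn, Real.rpow_add_one hsn.ne']
    field_simp
  have ht : 0 ≤ b / a * s n ^ α := by positivity
  generalize b / a * s n ^ α = t at ht hn_eq ⊢
  have hne : 1 + t ≠ 0 := by positivity
  have hsub : ((α + 1) / α * (1 + t))⁻¹ * n = s n * (α + 1 + t) / ((α + 1) * (1 + t)) := by
    conv_lhs => rw [hn_eq]
    field_simp
  simp only [id, hsub, mul_one]
  field_simp
  ring


/-- Fix `a > 0`, `α > 0`, `b ≥ 0`, and for each `n > 0` let `sstar n` be the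
unique root in `(0, n)` of `F(s) = α·a·n·s^(−α−1) − (α+1)·a·s^(−α) − b`. Then for every `n > 0`,
`0 ≥ d/dn (sstar n/n) ≥ −(α/(α+1))·(b/a)·n^(α−1)`; in particular, when `α < 1` the derivative
is uniformly bounded over `n ≥ 1` by `(α/(α+1))·(b/a)`. -/
theorem stmt_11 (a α b : ℝ) (ha : 0 < a) (hα : 0 < α) (hb : 0 ≤ b)
    (sstar : ℝ → ℝ)
    (hroot : ∀ n : ℝ, 0 < n → sstar n ∈ Set.Ioo (0 : ℝ) n ∧
      α * a * n * (sstar n) ^ (-α - 1) - (α + 1) * a * (sstar n) ^ (-α) - b = 0) :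
    (∀ n : ℝ, 0 < n →
      deriv (fun n : ℝ => sstar n / n) n ≤ 0 ∧
      -(α / (α + 1)) * (b / a) * n ^ (α - 1) ≤ deriv (fun n : ℝ => sstar n / n) n) ∧
    (α < 1 → ∀ n : ℝ, 1 ≤ n →
      |deriv (fun n : ℝ => sstar n / n) n| ≤ (α / (α + 1)) * (b / a)) := by
  have hs : ∀ n, 0 < n → 0 < sstar n := fun n hn => (hroot n hn).1.1
  have hderiv : ∀ n : ℝ, 0 < n → _ := fun n hn => (hasDerivAt_root_div ha hα hb hs
    (fun m hm => eq_of_root ha hα (hs m hm) (hroot m hm).2) hn).deriv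
  have hbounds : ∀ n : ℝ, 0 < n →
      deriv (fun n : ℝ => sstar n / n) n ≤ 0 ∧
      -(α / (α + 1)) * (b / a) * n ^ (α - 1) ≤ deriv (fun n : ℝ => sstar n / n) n := by
    intro n hn
    have hsn := hs n hn
    have hlt := (hroot n hn).1.2
    have ht : 0 ≤ b / a * sstar n ^ α := by positivity
    rw [hderiv n hn]
    refine ⟨neg_nonpos.2 (by positivity), ?_⟩
    rw [neg_mul, neg_mul, neg_le_neg_iff, mul_assoc (α / (α + 1))]
    refine mul_le_mul_of_nonneg_left ?_ (by positivity)
    calc b / a * sstar n ^ α * sstar n / ((1 + b / a * sstar n ^ α) * n ^ 2)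
        ≤ b / a * n ^ α * n / (1 * n ^ 2) := by
          gcongr
          linarith
      _ = b / a * n ^ (α - 1) := by
          rw [Real.rpow_sub_one hn.ne']
          field_simp
  refine ⟨hbounds, fun hα1 n hn => ?_⟩
  obtain ⟨hnonpos, hlower⟩ := hbounds n (by linarith)
  rw [abs_of_nonpos hnonpos]
  have hpow : n ^ (α - 1) ≤ 1 := Real.rpow_le_one_of_one_le_of_nonpos hn (by linarith)
  have hmul : α / (α + 1) * (b / a) * n ^ (α - 1) ≤ α / (α + 1) * (b / a) :=
    mul_le_of_le_one_right (by positivity) hpow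
  linarith
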